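/- Let T be a linear operator in H. If W(T) is a line, i.e. W(T) = {a + tb : t ∈ ℝ} for some a, b ∈ ℂ with b ≠ 0, then W_e(T) = W(T). Moreover, for any linear operator T in H, W(T) = ℂ if and only if W_e(T) = ℂ. -/

import Mathlib

open Filter Topology

noncomputable section

variable {H : Type*} [NormedAddCommGroup H] [InnerProductSpace ℂ H] [CompleteSpace H]

/-- A sequence in an inner product space converges weakly to zero. -/
def WeakNull {E : Type*} [NormedAddCommGroup E] [InnerProductSpace ℂ E] (x : ℕ → E) : Prop :=
  ∀ y : E, Tendsto (fun n => (inner ℂ (x n) y : ℂ)) atTop (nhds 0)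

/-- The numerical range of a (possibly unbounded) linear operator `T` in `H`,
`W(T) = {⟨Tx, x⟩ : x ∈ dom T, ‖x‖ = 1}`. -/
def numRange (T : H →ₗ.[ℂ] H) : Set ℂ :=
  {z | ∃ x : T.domain, ‖(x : H)‖ = 1 ∧ (inner ℂ ((x : H)) (T x) : ℂ) = z}

/-- The essential numerical range of a (possibly unbounded) linear operator `T` in `H`. -/
def essNumRange (T : H →ₗ.[ℂ] H) : Set ℂ :=
  {z | ∃ x : ℕ → T.domain, (∀ n, ‖((x n : H))‖ = 1) ∧
    WeakNull (fun n => ((x n : H))) ∧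
    Tendsto (fun n => (inner ℂ ((x n : H)) (T (x n)) : ℂ)) atTop (nhds z)}

/-- The essential spectrum `σ_e(T)` (the version `σ_{e2}` via singular Weyl sequences). -/
def essSpec (T : H →ₗ.[ℂ] H) : Set ℂ :=
  {z | ∃ x : ℕ → T.domain, (∀ n, ‖((x n : H))‖ = 1) ∧
    WeakNull (fun n => ((x n : H))) ∧
    Tendsto (fun n => ‖T (x n) - z • ((x n : H))‖) atTop (nhds 0)}

lemma aux_phase (A C : ℂ) : ∃ (e : ℂ) (s : ℝ), ‖e‖ = 1 ∧ 0 ≤ s ∧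
    e * A + (starRingEnd ℂ) e * C = s := by
  have h1 : ∃ e : ℂ, ‖e‖ = 1 ∧ (e * (A - (starRingEnd ℂ) C)).im = 0 := by
    by_cases hz : A - (starRingEnd ℂ) C = 0
    · exact ⟨1, by simp, by simp [hz]⟩
    · set z := A - (starRingEnd ℂ) C
      refine ⟨(starRingEnd ℂ) z / (‖z‖ : ℂ), ?_, ?_⟩
      · have : ‖z‖ ≠ 0 := by simpa using hz
        simp [this]
      · have : (starRingEnd ℂ) z / (‖z‖ : ℂ) * z = ((‖z‖ ^ 2 / ‖z‖ : ℝ) : ℂ) := by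
          rw [div_mul_eq_mul_div, mul_comm, Complex.mul_conj, Complex.normSq_eq_norm_sq]
          push_cast; rfl
        rw [this, Complex.ofReal_im]
  obtain ⟨e, he, him⟩ := h1
  have h2 : (e * A + (starRingEnd ℂ) e * C).im = 0 := by
    simp [Complex.mul_im] at him ⊢
    linarith
  have h3 : e * A + (starRingEnd ℂ) e * C = ((e * A + (starRingEnd ℂ) e * C).re : ℂ) :=
    Complex.ext (by simp) (by rw [h2]; simp)
  rcases le_total 0 (e * A + (starRingEnd ℂ) e * C).re with h | h
  · exact ⟨e, _, he, h, h3⟩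
  · refine ⟨-e, -(e * A + (starRingEnd ℂ) e * C).re, by simpa using he, by linarith, ?_⟩
    rw [Complex.ofReal_neg, ← h3, map_neg]; ring

lemma aux_quad (N s r : ℝ) (hN : 0 < N) (hs : 0 ≤ s) (hr : 0 ≤ r) :
    ∃ d : ℝ, 0 ≤ d ∧ d ^ 2 * N ≤ r ∧ d ^ 2 * N + d * s = r := by
  have hD : 0 ≤ s ^ 2 + 4 * N * r := by positivity
  have hsq := Real.sq_sqrt hD
  have hge : s ≤ Real.sqrt (s ^ 2 + 4 * N * r) := by
    apply Real.le_sqrt_of_sq_le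
    have : 0 ≤ 4 * N * r := by positivity
    linarith
  set S := Real.sqrt (s ^ 2 + 4 * N * r)
  have hd : 0 ≤ (S - s) / (2 * N) := div_nonneg (by linarith) (by linarith)
  have heq : ((S - s) / (2 * N)) ^ 2 * N + ((S - s) / (2 * N)) * s = r := by
    field_simp
    linarith
  exact ⟨_, hd, by nlinarith [mul_nonneg hd hs], heq⟩

lemma aux_B {E F : Type*} [NormedAddCommGroup F] [InnerProductSpace ℂ F]
    [AddCommGroup E] [Module ℂ E] (J S : E →ₗ[ℂ] F) (x y : E) (w : ℂ) (r N : ℝ)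
    (hw : w ≠ 0) (hr : 0 ≤ r) (hN : 0 < N)
    (hx : (inner ℂ (J x) (S x) : ℂ) = -(r * w)) (hy : (inner ℂ (J y) (S y) : ℂ) = N * w) :
    ∃ c : ℂ, ‖c‖ ^ 2 * N ≤ r ∧ (inner ℂ (J (x + c • y)) (S (x + c • y)) : ℂ) = 0 := by
  obtain ⟨e, s, he, hs, hes⟩ := aux_phase ((inner ℂ (J x) (S y) : ℂ) / w)
    ((inner ℂ (J y) (S x) : ℂ) / w)
  obtain ⟨d, hd, hle, heq⟩ := aux_quad N s r hN hs hr
  refine ⟨d * e, by simpa [he] using hle, ?_⟩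
  have hes' : e * (inner ℂ (J x) (S y) : ℂ) + (starRingEnd ℂ) e * (inner ℂ (J y) (S x) : ℂ)
      = s * w := by
    rw [← hes]; field_simp
  have hee : (starRingEnd ℂ) e * e = 1 := by
    rw [mul_comm, Complex.mul_conj, Complex.normSq_eq_norm_sq, he]; simp
  have heqC : (d : ℂ) ^ 2 * N + d * s = r := by exact_mod_cast heq
  simp only [map_add, map_smul, inner_add_left, inner_add_right, inner_smul_left,
    inner_smul_right, map_mul, Complex.conj_ofReal, hx, hy]
  linear_combination (d : ℂ) * hes' + (d : ℂ) ^ 2 * N * w * hee + w * heqC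

lemma numRange_bdd_of_fin (T : H →ₗ.[ℂ] H) [FiniteDimensional ℂ T.domain] :
    ∃ C : ℝ, ∀ z ∈ numRange T, ‖z‖ ≤ C := by
  refine ⟨‖LinearMap.toContinuousLinearMap T.toFun‖, ?_⟩
  rintro z ⟨x, hx, rfl⟩
  have h1 := (LinearMap.toContinuousLinearMap T.toFun).le_opNorm x
  have h2 : ‖x‖ = 1 := hx
  calc _ ≤ ‖(x : H)‖ * ‖T x‖ := norm_inner_le_norm _ _
    _ ≤ _ := by rw [hx, one_mul]; rw [h2, mul_one] at h1; exact h1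

lemma exists_onb (E : Type*) [NormedAddCommGroup E] [InnerProductSpace ℂ E]
    (h : ¬ FiniteDimensional ℂ E) : ∃ v : ℕ → E, Orthonormal ℂ v := by
  let b := Module.Basis.ofVectorSpace ℂ E
  have : Infinite (Module.Basis.ofVectorSpaceIndex ℂ E) := by
    by_contra hfin
    rw [not_infinite_iff_finite] at hfin
    exact h (Module.Finite.of_basis b)
  have hli := b.linearIndependent.comp _ (Infinite.natEmbedding
    (Module.Basis.ofVectorSpaceIndex ℂ E)).injective
  exact ⟨_, InnerProductSpace.gramSchmidtNormed_orthonormal hli⟩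

lemma weakNull_of_orthonormal {E : Type*} [NormedAddCommGroup E] [InnerProductSpace ℂ E]
    {v : ℕ → E} (hv : Orthonormal ℂ v) : WeakNull v := by
  intro y
  have h := (hv.inner_products_summable y).tendsto_atTop_zero
  rw [tendsto_zero_iff_norm_tendsto_zero]
  have h2 := (Real.continuous_sqrt.tendsto 0).comp h
  simpa [Function.comp_def] using h2

lemma mem_ess (T : H →ₗ.[ℂ] H) (hD : ¬ FiniteDimensional ℂ T.domain) (l : ℂ)
    (hl : ∀ μ ∈ numRange T, ∀ N : ℝ, 0 < N → l + N * (l - μ) ∈ numRange T) :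
    l ∈ essNumRange T := by
  obtain ⟨v, hv⟩ := exists_onb T.domain hD
  set S : T.domain →ₗ[ℂ] H := T.toFun - l • T.domain.subtype with hS
  have hq : ∀ x : T.domain, (inner ℂ (x : H) (S x) : ℂ) = inner ℂ (x : H) (T x) - l * ‖(x : H)‖ ^ 2 := by
    intro x
    have : S x = T x - l • (x : H) := rfl
    rw [this, inner_sub_right, inner_smul_right, inner_self_eq_norm_sq_to_K]; rfl
  have hv1 : ∀ n, ‖(v n : H)‖ = 1 := fun n => hv.1 n
  have key : ∀ n : ℕ, ∃ u : T.domain, ‖u - v n‖ ≤ 1 / ((n : ℝ) + 2) ∧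
      (inner ℂ (u : H) (S u) : ℂ) = 0 := by
    intro n
    have hn : (0 : ℝ) < (n : ℝ) + 2 := by positivity
    set μ : ℂ := inner ℂ (v n : H) (T (v n)) with hμ
    by_cases hw : l - μ = 0
    · refine ⟨v n, by simp; positivity, ?_⟩
      rw [hq, hv1, ← hμ]; simp; linear_combination -hw
    · have hN : (0 : ℝ) < ((n : ℝ) + 2) ^ 2 := by positivity
      obtain ⟨y, hy1, hy⟩ := hl μ ⟨v n, hv1 n, rfl⟩ _ hN
      obtain ⟨c, hc, hc0⟩ := aux_B T.domain.subtype S (v n) y (l - μ) 1 (((n : ℝ) + 2) ^ 2) hw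
        zero_le_one hN
        (by
          rw [Submodule.subtype_apply, hq, hv1, ← hμ]; push_cast; ring)
        (by
          rw [Submodule.subtype_apply, hq, hy1, hy]; push_cast; ring)
      refine ⟨v n + c • y, ?_, hc0⟩
      have hy1' : ‖y‖ = 1 := hy1
      rw [add_sub_cancel_left, norm_smul, hy1', mul_one, le_div_iff₀ hn]
      rw [← mul_pow] at hc
      exact (sq_le_one_iff₀ (by positivity)).1 hc
  choose u hu hu0 using key
  have hlow : ∀ n, 1 / 2 ≤ ‖u n‖ := by
    intro n
    have h1 := norm_sub_norm_le (v n) (u n)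
    rw [norm_sub_rev, hv.1 n] at h1
    have h2 : 1 / ((n : ℝ) + 2) ≤ 1 / 2 := by
      apply one_div_le_one_div_of_le <;> [norm_num; (have := n.cast_nonneg (α := ℝ); linarith)]
    linarith [hu n]
  have hpos : ∀ n, 0 < ‖u n‖ := fun n => by linarith [hlow n]
  have hx1 : ∀ n, ‖((((‖u n‖⁻¹ : ℝ) : ℂ) • u n : T.domain) : H)‖ = 1 := by
    intro n
    change ‖((‖u n‖⁻¹ : ℝ) : ℂ) • u n‖ = 1
    rw [norm_smul, Complex.norm_real, norm_inv, norm_norm, inv_mul_cancel₀ (hpos n).ne']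
  refine ⟨fun n => ((‖u n‖⁻¹ : ℝ) : ℂ) • u n, hx1, ?_, ?_⟩
  · intro z
    have hvH : Orthonormal ℂ (fun n => (v n : H)) := hv.comp_linearIsometry T.domain.subtypeₗᵢ
    have h1 := (weakNull_of_orthonormal hvH z).norm
    have h2 : Tendsto (fun n : ℕ => 1 / ((n : ℝ) + 2)) atTop (nhds 0) := by
      have h3 := (tendsto_one_div_add_atTop_nhds_zero_nat (𝕜 := ℝ)).comp (tendsto_add_atTop_nat 1)
      refine h3.congr fun n => ?_
      simp only [Function.comp]
      push_cast
      congr 1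
      ring
    have h4 : Tendsto (fun n : ℕ => 2 * (‖(inner ℂ (v n : H) z : ℂ)‖ + 1 / ((n : ℝ) + 2) * ‖z‖))
        atTop (nhds 0) := by
      have := (h1.add (h2.mul_const ‖z‖)).const_mul 2
      simpa using this
    refine squeeze_zero_norm (fun n => ?_) h4
    have h5 : (inner ℂ (u n : H) z : ℂ) = inner ℂ (v n : H) z + inner ℂ ((u n - v n : T.domain) : H) z := by
      rw [← inner_add_left]; simp
    have h6 : ‖(inner ℂ (u n : H) z : ℂ)‖ ≤ ‖(inner ℂ (v n : H) z : ℂ)‖ + 1 / ((n : ℝ) + 2) * ‖z‖ := by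
      rw [h5]
      refine (norm_add_le _ _).trans ?_
      gcongr
      refine (norm_inner_le_norm _ _).trans ?_
      gcongr
      exact hu n
    have h7 : ‖u n‖⁻¹ ≤ 2 := by
      have := inv_anti₀ (by norm_num) (hlow n)
      simpa using this
    beta_reduce
    rw [Submodule.coe_smul, inner_smul_left, norm_mul, Complex.conj_ofReal, Complex.norm_real,
      norm_inv, norm_norm]
    gcongr
  · refine tendsto_const_nhds.congr fun n => ?_
    have h1 := hq (((‖u n‖⁻¹ : ℝ) : ℂ) • u n)
    rw [hx1, map_smul, Submodule.coe_smul, inner_smul_left, inner_smul_right, hu0] at h1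
    simp only [mul_zero, Complex.ofReal_one, one_pow, mul_one] at h1
    exact (sub_eq_zero.1 h1.symm).symm

lemma ess_subset (T : H →ₗ.[ℂ] H) : essNumRange T ⊆ closure (numRange T) := by
  rintro z ⟨x, h1, -, h3⟩
  exact mem_closure_of_tendsto h3 (Eventually.of_forall fun n => ⟨x n, h1 n, rfl⟩)

lemma numRange_convex (T : H →ₗ.[ℂ] H) : Convex ℝ (numRange T) := by
  rw [convex_iff_openSegment_subset]
  rintro p ⟨x, hx, rfl⟩ q' ⟨y, hy, rfl⟩ l ⟨a, b, ha, hb, hab, rfl⟩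
  set p : ℂ := inner ℂ (x : H) (T x) with hp
  set q : ℂ := inner ℂ (y : H) (T y) with hqd
  set l : ℂ := a • p + b • q with hl
  have habC : (a : ℂ) + b = 1 := by exact_mod_cast hab
  have hl' : l = a * p + b * q := by simp [hl]
  by_cases hpq : q - p = 0
  · refine ⟨x, hx, ?_⟩
    rw [← hp, hl']
    linear_combination -p * habC - b * hpq
  set S : T.domain →ₗ[ℂ] H := T.toFun - l • T.domain.subtype with hS
  have hq : ∀ x : T.domain, (inner ℂ (x : H) (S x) : ℂ) = inner ℂ (x : H) (T x) - l * ‖(x : H)‖ ^ 2 := by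
    intro x
    have : S x = T x - l • (x : H) := rfl
    rw [this, inner_sub_right, inner_smul_right, inner_self_eq_norm_sq_to_K]; rfl
  have hSx : (inner ℂ (x : H) (S x) : ℂ) = -(b * (q - p)) := by
    rw [hq, hx, ← hp, hl']; push_cast; linear_combination -p * habC
  have hSy : (inner ℂ (y : H) (S y) : ℂ) = a * (q - p) := by
    rw [hq, hy, ← hqd, hl']; push_cast; linear_combination -q * habC
  obtain ⟨c, -, hc0⟩ := aux_B T.domain.subtype S x y (q - p) b a hpq hb.le ha hSx hSy
  rw [Submodule.subtype_apply] at hc0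
  have hne : x + c • y ≠ 0 := by
    intro h0
    have hxy : x = (-c) • y := by rw [neg_smul]; exact eq_neg_of_add_eq_zero_left h0
    have h1 := hSx
    rw [hxy, map_smul, Submodule.coe_smul, inner_smul_left, inner_smul_right, hSy, ← mul_assoc,
      mul_comm ((starRingEnd ℂ) (-c)), Complex.mul_conj] at h1
    have h2 : ((Complex.normSq (-c) * a + b : ℝ) : ℂ) * (q - p) = 0 := by
      push_cast; linear_combination h1
    rcases mul_eq_zero.1 h2 with h3 | h3
    · have h4 : Complex.normSq (-c) * a + b = 0 := by exact_mod_cast h3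
      have := mul_nonneg (Complex.normSq_nonneg (-c)) ha.le
      linarith
    · exact hpq h3
  set u := x + c • y
  have hpos : 0 < ‖u‖ := norm_pos_iff.2 hne
  have hx1 : ‖((((‖u‖⁻¹ : ℝ) : ℂ) • u : T.domain) : H)‖ = 1 := by
    change ‖((‖u‖⁻¹ : ℝ) : ℂ) • u‖ = 1
    rw [norm_smul, Complex.norm_real, norm_inv, norm_norm, inv_mul_cancel₀ hpos.ne']
  refine ⟨((‖u‖⁻¹ : ℝ) : ℂ) • u, hx1, ?_⟩
  have h1 := hq (((‖u‖⁻¹ : ℝ) : ℂ) • u)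
  rw [hx1, map_smul, Submodule.coe_smul, inner_smul_left, inner_smul_right, hc0] at h1
  simp only [mul_zero, Complex.ofReal_one, one_pow, mul_one] at h1
  exact sub_eq_zero.1 h1.symm

lemma convex_dense_univ {s : Set ℂ} (hs : Convex ℝ s) (hd : closure s = Set.univ) :
    s = Set.univ := by
  have h1 : affineSpan ℝ s = ⊤ := by
    have hc : IsClosed (affineSpan ℝ s : Set ℂ) := AffineSubspace.closed_of_finiteDimensional _
    have h2 := closure_minimal (subset_affineSpan ℝ s) hc
    rw [hd] at h2
    exact SetLike.coe_injective (Set.univ_subset_iff.1 h2)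
  have h2 := hs.interior_closure_eq_interior_of_nonempty_interior
    (hs.interior_nonempty_iff_affineSpan_eq_top.2 h1)
  rw [hd, interior_univ] at h2
  exact Set.univ_subset_iff.1 (h2 ▸ interior_subset)

/-- Cor. 2.6 i) and iv): if `W(T)` is a line then `W_e(T) = W(T)`; moreover
`W(T) = ℂ` if and only if `W_e(T) = ℂ`. -/
theorem essNumRange_eq_numRange_of_line_and_univ_iff
    [TopologicalSpace.SeparableSpace H] (hinf : ¬FiniteDimensional ℂ H)
    (T : H →ₗ.[ℂ] H) :
    ((∃ a b : ℂ, b ≠ 0 ∧ numRange T = {z : ℂ | ∃ t : ℝ, z = a + (t : ℂ) * b}) →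
      essNumRange T = numRange T) ∧
    (numRange T = Set.univ ↔ essNumRange T = Set.univ) := by
  refine ⟨?_, ?_, ?_⟩
  · rintro ⟨a, b, hb, hW⟩
    have hD : ¬ FiniteDimensional ℂ T.domain := by
      intro hfin
      obtain ⟨C, hC⟩ := numRange_bdd_of_fin T
      have h1 := hC (a + (((‖a‖ + C + 1) / ‖b‖ : ℝ) : ℂ) * b) (by rw [hW]; exact ⟨_, rfl⟩)
      have h0 := hC a (by rw [hW]; exact ⟨0, by simp⟩)
      have hb' : 0 < ‖b‖ := norm_pos_iff.2 hb
      have hC0 : 0 ≤ C := (norm_nonneg a).trans h0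
      have h2 : ‖(((‖a‖ + C + 1) / ‖b‖ : ℝ) : ℂ) * b‖ = ‖a‖ + C + 1 := by
        rw [norm_mul, Complex.norm_real, Real.norm_of_nonneg (by positivity),
          div_mul_cancel₀ _ hb'.ne']
      have h3 := norm_sub_le (a + (((‖a‖ + C + 1) / ‖b‖ : ℝ) : ℂ) * b) a
      rw [add_sub_cancel_left, h2] at h3
      linarith
    apply Set.Subset.antisymm
    · have hcl : IsClosed (numRange T) := by
        have : numRange T = {z : ℂ | ((z - a) / b).im = 0} := by
          rw [hW]
          ext z
          constructor
          · rintro ⟨t, rfl⟩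
            simp [hb]
          · intro hz
            refine ⟨((z - a) / b).re, ?_⟩
            have h1 : ((((z - a) / b).re : ℝ) : ℂ) = (z - a) / b :=
              Complex.ext (by simp) (by rw [Complex.ofReal_im]; exact hz.symm)
            rw [h1]; field_simp; ring
        rw [this]
        exact isClosed_eq (by fun_prop) continuous_const
      exact (ess_subset T).trans hcl.closure_eq.subset
    · intro l hl
      apply mem_ess T hD
      intro μ hμ N _
      rw [hW] at hl hμ ⊢
      obtain ⟨t, rfl⟩ := hl
      obtain ⟨t', rfl⟩ := hμ
      exact ⟨t + N * (t - t'), by push_cast; ring⟩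
  · intro hW
    have hD : ¬ FiniteDimensional ℂ T.domain := by
      intro hfin
      obtain ⟨C, hC⟩ := numRange_bdd_of_fin T
      have h1 := hC ((|C| + 1 : ℝ) : ℂ) (by rw [hW]; trivial)
      rw [Complex.norm_real, Real.norm_of_nonneg (by positivity)] at h1
      linarith [le_abs_self C]
    refine Set.eq_univ_of_forall fun l => mem_ess T hD l fun _ _ _ _ => by rw [hW]; trivial
  · intro hW
    exact convex_dense_univ (numRange_convex T)
      (Set.univ_subset_iff.1 (hW ▸ ess_subset T))
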